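/- For u in the Schwartz space on ℝⁿ and K(z) = a(z/|z|)|z|^{−n−2s} with a ∈ L^∞(S^{n-1}) even and s ∈ (0,1), the Fourier transform of x ↦ (1/2)∫_{ℝⁿ}(2u(x) − u(x+z) − u(x−z))K(z)dz equals ξ ↦ S(ξ)·(ℱu)(ξ), where S(ξ) = ∫_{ℝⁿ} (1 − cos(ξ·z)) K(z) dz. -/

import Mathlib

open MeasureTheory
open scoped RealInnerProductSpace

/-- A Fourier transform on `ℝⁿ` (convention `∫ e^{-i⟨x,ξ⟩} f(x) dx`). -/
noncomputable def fourierT {n : ℕ} (f : EuclideanSpace ℝ (Fin n) → ℂ)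
    (ξ : EuclideanSpace ℝ (Fin n)) : ℂ :=
  ∫ x : EuclideanSpace ℝ (Fin n), Complex.exp (-Complex.I * (⟪x, ξ⟫ : ℝ)) * f x

/-- A second-order difference of a `C²` function is controlled by its second derivative. -/
lemma norm_second_difference_le {E F : Type*} [NormedAddCommGroup E] [NormedSpace ℝ E]
    [NormedAddCommGroup F] [NormedSpace ℝ F] {f : E → F} (hf : Differentiable ℝ f)
    (hf' : Differentiable ℝ (fderiv ℝ f)) {x z : E} {M : ℝ}
    (hM : ∀ y ∈ Metric.closedBall x ‖z‖, ‖fderiv ℝ (fderiv ℝ f) y‖ ≤ M) :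
    ‖(2 : ℝ) • f x - f (x + z) - f (x - z)‖ ≤ 2 * M * ‖z‖ ^ 2 := by
  have hM0 : 0 ≤ M := (norm_nonneg (fderiv ℝ (fderiv ℝ f) x)).trans (hM x (by simp))
  have hlip : ∀ w ∈ Metric.closedBall (0 : E) ‖z‖,
      ‖fderiv ℝ f (x + w) - fderiv ℝ f (x - w)‖ ≤ 2 * M * ‖z‖ := by
    intro w hw
    rw [mem_closedBall_zero_iff] at hw
    have h := (convex_closedBall x ‖z‖).norm_image_sub_le_of_norm_fderiv_le
      (𝕜 := ℝ) (f := fderiv ℝ f) (x := x - w) (y := x + w) (fun y _ => hf' y) hM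
      (by simpa [dist_eq_norm] using hw) (by simpa [dist_eq_norm] using hw)
    have h2 : ‖x + w - (x - w)‖ ≤ 2 * ‖z‖ := by
      rw [show x + w - (x - w) = (2 : ℝ) • w by rw [two_smul]; abel, norm_smul]
      norm_num
      exact hw
    calc _ ≤ M * ‖x + w - (x - w)‖ := h
      _ ≤ M * (2 * ‖z‖) := by gcongr
      _ = _ := by ring
  have hder : ∀ w : E, HasFDerivAt (fun w => f (x + w) + f (x - w))
      (fderiv ℝ f (x + w) - fderiv ℝ f (x - w)) w := by
    intro w
    have h1 : HasFDerivAt (fun w => f (x + w)) (fderiv ℝ f (x + w)) w :=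
      (hasFDerivAt_comp_add_left x).2 (hf _).hasFDerivAt
    have h2 : HasFDerivAt (fun w => f (x - w)) (-fderiv ℝ f (x - w)) w := by
      have := (hf (x - w)).hasFDerivAt.comp w ((hasFDerivAt_id w).const_sub x)
      simpa [Function.comp_def] using this
    rw [sub_eq_add_neg]
    exact h1.add h2
  have h := (convex_closedBall (0 : E) ‖z‖).norm_image_sub_le_of_norm_hasFDerivWithin_le
    (fun w _ => (hder w).hasFDerivWithinAt) hlip (x := 0) (y := z) (by simp) (by simp)
  simp only [add_zero, sub_zero] at h
  rw [show (2 : ℝ) • f x - f (x + z) - f (x - z) = -(f (x + z) + f (x - z) - (f x + f x)) by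
    rw [two_smul]; abel, norm_neg]
  calc _ ≤ 2 * M * ‖z‖ * ‖z‖ := h
    _ = _ := by ring

/-- The second-order difference `(x, z) ↦ 2 u(x) - u(x + z) - u(x - z)` of a Schwartz function
is `O(|z|²)` for `|z| ≤ 1`, with rapid decay in `x`. -/
lemma SchwartzMap.exists_abs_second_difference_le {E : Type*} [NormedAddCommGroup E]
    [NormedSpace ℝ E] (u : SchwartzMap E ℝ) (k : ℕ) :
    ∃ C, ∀ x z : E, ‖z‖ ≤ 1 →
      |2 * u x - u (x + z) - u (x - z)| ≤ C * ‖z‖ ^ 2 * (1 + ‖x‖) ^ (-(k : ℝ)) := by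
  set w := SchwartzMap.fderivCLM ℝ E ℝ u with hw
  have hwu : ∀ y, w y = fderiv ℝ u y := fun y => SchwartzMap.fderivCLM_apply ℝ u y
  have hwu' : (w : E → E →L[ℝ] ℝ) = fderiv ℝ u := funext hwu
  set B := 2 ^ k * ((Finset.Iic (k, 1)).sup fun m => SchwartzMap.seminorm ℝ m.1 m.2) w with hB
  have hdec : ∀ y, (1 + ‖y‖) ^ k * ‖fderiv ℝ (fderiv ℝ u) y‖ ≤ B := by
    intro y
    have := SchwartzMap.one_add_le_sup_seminorm_apply (𝕜 := ℝ) (m := (k, 1)) (k := k) (n := 1)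
      le_rfl le_rfl w y
    rwa [norm_iteratedFDeriv_one, hwu'] at this
  refine ⟨2 * (2 ^ k * B), fun x z hz => ?_⟩
  have hx : 0 < (1 + ‖x‖) ^ k := by positivity
  have h := norm_second_difference_le (f := u) (x := x) (z := z)
    (M := 2 ^ k * B * ((1 + ‖x‖) ^ k)⁻¹) u.differentiable (hwu' ▸ w.differentiable) (by
      intro y hy
      rw [← div_eq_mul_inv, le_div_iff₀ hx]
      have hyx : 1 + ‖x‖ ≤ 2 * (1 + ‖y‖) := by
        have h1 : ‖x‖ ≤ ‖y‖ + ‖y - x‖ := by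
          simpa using norm_sub_le y (y - x)
        rw [mem_closedBall_iff_norm] at hy
        linarith [norm_nonneg y]
      calc ‖fderiv ℝ (fderiv ℝ u) y‖ * (1 + ‖x‖) ^ k
          ≤ ‖fderiv ℝ (fderiv ℝ u) y‖ * (2 * (1 + ‖y‖)) ^ k := by gcongr
        _ = 2 ^ k * ((1 + ‖y‖) ^ k * ‖fderiv ℝ (fderiv ℝ u) y‖) := by rw [mul_pow]; ring
        _ ≤ 2 ^ k * B := by gcongr; exact hdec y)
  rw [Real.rpow_neg (by positivity), Real.rpow_natCast]
  rw [smul_eq_mul, Real.norm_eq_abs] at h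
  calc _ ≤ _ := h
    _ = _ := by ring

lemma SchwartzMap.integrable_second_difference {E : Type*} [NormedAddCommGroup E]
    [NormedSpace ℝ E] [FiniteDimensional ℝ E] [MeasurableSpace E] [BorelSpace E]
    (μ : Measure E) [μ.IsAddHaarMeasure] (u : SchwartzMap E ℝ) (z : E) :
    Integrable (fun x => 2 * u x - u (x + z) - u (x - z)) μ :=
  ((u.integrable.const_mul 2).sub (u.integrable.comp_add_right z)).sub
    (u.integrable.comp_sub_right z)

/-- The `L¹` norm of a second-order difference of a Schwartz function is `O(min(1, |z|²))`. -/
lemma SchwartzMap.exists_integral_abs_second_difference_le {E : Type*} [NormedAddCommGroup E]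
    [NormedSpace ℝ E] [FiniteDimensional ℝ E] [MeasurableSpace E] [BorelSpace E]
    (μ : Measure E) [μ.IsAddHaarMeasure] (u : SchwartzMap E ℝ) :
    ∃ C, ∀ z : E, ∫ x, |2 * u x - u (x + z) - u (x - z)| ∂μ ≤ C * min 1 (‖z‖ ^ 2) := by
  obtain ⟨C, hC⟩ := u.exists_abs_second_difference_le (Module.finrank ℝ E + 1)
  have hint : Integrable (fun x : E => (1 + ‖x‖) ^ (-((Module.finrank ℝ E + 1 : ℕ) : ℝ))) μ :=
    integrable_one_add_norm (by push_cast; linarith)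
  set I := ∫ x : E, (1 + ‖x‖) ^ (-((Module.finrank ℝ E + 1 : ℕ) : ℝ)) ∂μ
  have hu := u.integrable (μ := μ)
  refine ⟨max (C * I) (4 * ∫ x, |u x| ∂μ), fun z => ?_⟩
  by_cases hz : ‖z‖ ≤ 1
  · calc ∫ x, |2 * u x - u (x + z) - u (x - z)| ∂μ
        ≤ ∫ x, C * ‖z‖ ^ 2 * (1 + ‖x‖) ^ (-((Module.finrank ℝ E + 1 : ℕ) : ℝ)) ∂μ :=
          integral_mono (u.integrable_second_difference μ z).abs (hint.const_mul _)
            (fun x => hC x z hz)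
      _ = (C * I) * ‖z‖ ^ 2 := by rw [integral_const_mul]; ring
      _ ≤ _ := by
        rw [min_eq_right (pow_le_one₀ (norm_nonneg z) hz)]
        gcongr
        exact le_max_left _ _
  · have h2 : Integrable (fun x => 2 * |u x| + |u (x + z)|) μ :=
      (hu.abs.const_mul 2).add (hu.abs.comp_add_right z)
    calc ∫ x, |2 * u x - u (x + z) - u (x - z)| ∂μ
        ≤ ∫ x, (2 * |u x| + |u (x + z)|) + |u (x - z)| ∂μ := by
          refine integral_mono (u.integrable_second_difference μ z).abs
            (h2.add (hu.abs.comp_sub_right z)) (fun x => ?_)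
          calc |2 * u x - u (x + z) - u (x - z)|
              ≤ |2 * u x - u (x + z)| + |u (x - z)| := abs_sub _ _
            _ ≤ |2 * u x| + |u (x + z)| + |u (x - z)| := by gcongr; exact abs_sub _ _
            _ = _ := by rw [abs_mul, abs_two]
      _ = 4 * ∫ x, |u x| ∂μ := by
          rw [integral_add h2 (hu.abs.comp_sub_right z),
            integral_add (hu.abs.const_mul 2) (hu.abs.comp_add_right z), integral_const_mul,
            integral_add_right_eq_self (fun x => |u x|) z,
            integral_sub_right_eq_self (fun x => |u x|) z]
          ring
      _ ≤ _ := by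
        rw [min_eq_left (one_le_pow₀ (not_le.1 hz).le), mul_one]
        exact le_max_right _ _

lemma integrable_min_one_sq_mul_norm_rpow {E : Type*} [NormedAddCommGroup E]
    [NormedSpace ℝ E] [FiniteDimensional ℝ E] [Nontrivial E] [MeasurableSpace E] [BorelSpace E]
    (μ : Measure E) [μ.IsAddHaarMeasure] {s : ℝ} (hs : s ∈ Set.Ioo (0 : ℝ) 1) :
    Integrable (fun z : E =>
      min 1 (‖z‖ ^ 2) * ‖z‖ ^ (-((Module.finrank ℝ E : ℝ) + 2 * s))) μ := by
  have hd : 1 ≤ Module.finrank ℝ E := Module.finrank_pos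
  rw [integrable_fun_norm_addHaar μ
    (f := fun r : ℝ => min 1 (r ^ 2) * r ^ (-((Module.finrank ℝ E : ℝ) + 2 * s)))]
  have hpow : ∀ r : ℝ, 0 < r →
      r ^ (Module.finrank ℝ E - 1) * r ^ (-((Module.finrank ℝ E : ℝ) + 2 * s))
        = r ^ (-1 - 2 * s) := by
    intro r hr
    rw [← Real.rpow_natCast, ← Real.rpow_add hr, Nat.cast_sub hd]
    congr 1
    push_cast
    ring
  rw [← Set.Ioc_union_Ioi_eq_Ioi (zero_le_one' ℝ)]
  refine IntegrableOn.union ?_ ?_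
  · have h : IntegrableOn (fun r : ℝ => r ^ (1 - 2 * s)) (Set.Ioc 0 1) :=
      (intervalIntegral.intervalIntegrable_rpow' (a := 0) (b := 1)
        (by linarith [hs.2])).1
    refine h.congr_fun (fun r hr => ?_) measurableSet_Ioc
    have hr1 : r ^ 2 ≤ 1 := pow_le_one₀ hr.1.le hr.2
    simp only [smul_eq_mul, min_eq_right hr1]
    rw [mul_left_comm, hpow r hr.1, ← Real.rpow_natCast, ← Real.rpow_add hr.1]
    congr 1
    push_cast
    ring
  · refine (integrableOn_Ioi_rpow_of_lt (a := -1 - 2 * s) (by linarith [hs.1])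
      zero_lt_one).congr_fun (fun r hr => ?_) measurableSet_Ioi
    have hr0 : 0 < r := zero_lt_one.trans hr
    simp only [smul_eq_mul, min_eq_left (one_le_pow₀ (le_of_lt hr) : 1 ≤ r ^ 2), one_mul]
    exact (hpow r hr0).symm

/-- Integrability of a second-order difference quotient of a Schwartz function over the product
space, for a kernel dominated by `|z|^{-n-2s}`. -/
lemma SchwartzMap.integrable_second_difference_mul_kernel {E : Type*} [NormedAddCommGroup E]
    [NormedSpace ℝ E] [FiniteDimensional ℝ E] [Nontrivial E] [MeasurableSpace E] [BorelSpace E]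
    (μ : Measure E) [μ.IsAddHaarMeasure] (u : SchwartzMap E ℝ) {s : ℝ}
    (hs : s ∈ Set.Ioo (0 : ℝ) 1) {K : E → ℝ} (hK : Measurable K) {A : ℝ}
    (hKA : ∀ z ≠ 0, |K z| ≤ A * ‖z‖ ^ (-((Module.finrank ℝ E : ℝ) + 2 * s))) :
    Integrable (fun p : E × E => (2 * u p.1 - u (p.1 + p.2) - u (p.1 - p.2)) * K p.2)
      (μ.prod μ) := by
  have hD : Continuous fun p : E × E => 2 * u p.1 - u (p.1 + p.2) - u (p.1 - p.2) := by
    have := u.continuous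
    fun_prop
  have hmeas : Measurable
      fun p : E × E => (2 * u p.1 - u (p.1 + p.2) - u (p.1 - p.2)) * K p.2 :=
    hD.measurable.mul (hK.comp measurable_snd)
  obtain ⟨C, hC⟩ := u.exists_integral_abs_second_difference_le μ
  rw [integrable_prod_iff' hmeas.aestronglyMeasurable]
  refine ⟨.of_forall fun z => (u.integrable_second_difference μ z).mul_const (K z), ?_⟩
  refine ((integrable_min_one_sq_mul_norm_rpow μ hs).const_mul (C * A)).mono'
    hmeas.aestronglyMeasurable.norm.prod_swap.integral_prod_right' ?_
  filter_upwards [Measure.ae_ne μ 0] with z hz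
  simp only [norm_mul, Real.norm_eq_abs, integral_mul_const]
  have h0 : 0 ≤ ∫ x, |2 * u x - u (x + z) - u (x - z)| ∂μ := integral_nonneg fun x => abs_nonneg _
  rw [abs_abs, abs_of_nonneg h0]
  calc _ ≤ (C * min 1 (‖z‖ ^ 2)) * (A * ‖z‖ ^ (-((Module.finrank ℝ E : ℝ) + 2 * s))) :=
        mul_le_mul (hC z) (hKA z hz) (abs_nonneg _) (h0.trans (hC z))
    _ = _ := by ring

lemma fourierT_comp_add_right {n : ℕ} (f : EuclideanSpace ℝ (Fin n) → ℂ)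
    (z ξ : EuclideanSpace ℝ (Fin n)) :
    fourierT (fun x => f (x + z)) ξ = Complex.exp (Complex.I * (⟪ξ, z⟫ : ℝ)) * fourierT f ξ := by
  unfold fourierT
  rw [← integral_const_mul, ← integral_add_right_eq_self
    (fun x => Complex.exp (Complex.I * (⟪ξ, z⟫ : ℝ)) *
      (Complex.exp (-Complex.I * (⟪x, ξ⟫ : ℝ)) * f x)) z]
  congr 1 with x
  rw [← mul_assoc, ← Complex.exp_add, inner_add_left, real_inner_comm z ξ]
  congr 2
  push_cast
  ring

lemma norm_exp_neg_I_mul_ofReal (r : ℝ) : ‖Complex.exp (-Complex.I * (r : ℂ))‖ = 1 := by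
  rw [show -Complex.I * (r : ℂ) = ((-r : ℝ) : ℂ) * Complex.I by push_cast; ring]
  exact Complex.norm_exp_ofReal_mul_I _

lemma MeasureTheory.Integrable.exp_neg_I_inner_mul {n : ℕ} {f : EuclideanSpace ℝ (Fin n) → ℂ}
    (hf : Integrable f) (ξ : EuclideanSpace ℝ (Fin n)) :
    Integrable fun x => Complex.exp (-Complex.I * (⟪x, ξ⟫ : ℝ)) * f x :=
  hf.bdd_mul (c := 1) (by fun_prop) (.of_forall fun x => (norm_exp_neg_I_mul_ofReal _).le)

/-- The Fourier transform of a second-order difference: the multiplier is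
`2 - e^{iξ·z} - e^{-iξ·z} = 2 (1 - cos (ξ·z))`. -/
lemma fourierT_second_difference {n : ℕ} {f : EuclideanSpace ℝ (Fin n) → ℂ} (hf : Integrable f)
    (z ξ : EuclideanSpace ℝ (Fin n)) :
    fourierT (fun x => 2 * f x - f (x + z) - f (x - z)) ξ
      = 2 * ((1 - Real.cos ⟪ξ, z⟫ : ℝ) : ℂ) * fourierT f ξ := by
  have h1 := hf.exp_neg_I_inner_mul ξ
  have h2 := (hf.comp_add_right z).exp_neg_I_inner_mul ξ
  have h3 := (hf.comp_add_right (-z)).exp_neg_I_inner_mul ξ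
  have key : fourierT (fun x => 2 * f x - f (x + z) - f (x - z)) ξ
      = 2 * fourierT f ξ - fourierT (fun x => f (x + z)) ξ
        - fourierT (fun x => f (x + -z)) ξ := by
    unfold fourierT
    have h12 : Integrable fun x => 2 * (Complex.exp (-Complex.I * (⟪x, ξ⟫ : ℝ)) * f x)
        - Complex.exp (-Complex.I * (⟪x, ξ⟫ : ℝ)) * f (x + z) := (h1.const_mul 2).sub h2
    rw [← integral_const_mul, ← integral_sub (h1.const_mul 2) h2, ← integral_sub h12 h3]
    congr 1 with x
    simp only [sub_eq_add_neg x z]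
    ring
  rw [key, fourierT_comp_add_right, fourierT_comp_add_right, inner_neg_right]
  have hcos := Complex.two_cos (⟪ξ, z⟫ : ℝ)
  push_cast
  rw [mul_sub, hcos]
  ring_nf

/-- For a Schwartz function `u` and the anisotropic kernel
`K(z) = a(z/|z|)|z|^{−n−2s}` with `a ∈ L^∞(S^{n−1})` even and `s ∈ (0,1)`, the Fourier
transform of `x ↦ (1/2)∫ (2u(x) − u(x+z) − u(x−z)) K(z) dz` is `ξ ↦ S(ξ)·(ℱu)(ξ)`,
where `S(ξ) = ∫ (1 − cos(ξ·z)) K(z) dz`. -/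
theorem fourier_transform_of_nonlocal_operator
    {n : ℕ} (hn : 1 ≤ n) (s : ℝ) (hs : s ∈ Set.Ioo (0 : ℝ) 1)
    (u : SchwartzMap (EuclideanSpace ℝ (Fin n)) ℝ)
    (a : EuclideanSpace ℝ (Fin n) → ℝ) (ha : Measurable a)
    (A : ℝ) (haA : ∀ v ∈ Metric.sphere (0 : EuclideanSpace ℝ (Fin n)) 1, |a v| ≤ A)
    (haeven : ∀ v, a (-v) = a v) :
    ∀ ξ : EuclideanSpace ℝ (Fin n),
      fourierT (fun x => (((1 : ℝ) / 2) * ∫ z : EuclideanSpace ℝ (Fin n),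
          (2 * u x - u (x + z) - u (x - z)) *
            (a (‖z‖⁻¹ • z) * ‖z‖ ^ (-((n : ℝ) + 2 * s))) : ℂ)) ξ
        = ((∫ z : EuclideanSpace ℝ (Fin n),
            (1 - Real.cos ⟪ξ, z⟫) *
              (a (‖z‖⁻¹ • z) * ‖z‖ ^ (-((n : ℝ) + 2 * s))) : ℝ) : ℂ) *
          fourierT (fun x => ((u x : ℝ) : ℂ)) ξ := by
  intro ξ
  have : Nontrivial (EuclideanSpace ℝ (Fin n)) :=
    Module.nontrivial_of_finrank_pos (R := ℝ) (by rw [finrank_euclideanSpace_fin]; omega)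
  set K : EuclideanSpace ℝ (Fin n) → ℝ :=
    fun z => a (‖z‖⁻¹ • z) * ‖z‖ ^ (-((n : ℝ) + 2 * s)) with hK
  have hKm : Measurable K := by fun_prop
  have hKA : ∀ z ≠ 0, |K z| ≤
      A * ‖z‖ ^ (-((Module.finrank ℝ (EuclideanSpace ℝ (Fin n)) : ℝ) + 2 * s)) := by
    intro z hz
    rw [finrank_euclideanSpace_fin, hK, abs_mul, abs_of_nonneg (Real.rpow_nonneg (norm_nonneg z) _)]
    gcongr
    exact haA _ (by simp [norm_smul, hz])
  have hint := u.integrable_second_difference_mul_kernel volume hs hKm hKA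
  have hu : Integrable fun x => ((u x : ℝ) : ℂ) := u.integrable.ofReal
  set F : EuclideanSpace ℝ (Fin n) → EuclideanSpace ℝ (Fin n) → ℂ := fun x z =>
    Complex.exp (-Complex.I * (⟪x, ξ⟫ : ℝ)) *
      (((2 * u x - u (x + z) - u (x - z)) * K z : ℝ) : ℂ) with hF
  have hFint : Integrable (Function.uncurry F) (volume.prod volume) :=
    hint.ofReal.bdd_mul (c := 1) (by fun_prop)
      (.of_forall fun p => (norm_exp_neg_I_mul_ofReal _).le)
  calc _ = 1 / 2 * ∫ x, ∫ z, F x z := by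
        rw [fourierT, ← integral_const_mul]
        congr 1 with x
        rw [integral_const_mul, integral_complex_ofReal]
        push_cast
        ring
    _ = 1 / 2 * ∫ z, ∫ x, F x z := by rw [integral_integral_swap hFint]
    _ = 1 / 2 * ∫ z, 2 * fourierT (fun x => ((u x : ℝ) : ℂ)) ξ *
          (((1 - Real.cos ⟪ξ, z⟫) * K z : ℝ) : ℂ) := by
        congr 2 with z
        calc ∫ x, F x z
            = fourierT (fun x => 2 * (u x : ℂ) - (u (x + z) : ℂ) - (u (x - z) : ℂ)) ξ * K z := by
              rw [fourierT, ← integral_mul_const]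
              congr 1 with x
              simp only [hF]
              push_cast
              ring
          _ = _ := by
              rw [fourierT_second_difference hu z ξ]
              push_cast
              ring
    _ = _ := by
        rw [integral_const_mul, integral_complex_ofReal]
        ring
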